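/- Let f(ϑ) = ϑ A(ϑ) + (1-ϑ) B(ϑ) on [0,1], where A(ϑ) = 1 - a₁ e^{k₁ ϑ t} (a₁ ∈ (0,1), k₁, t > 0) and B(ϑ) = ∑_{n≥1} k₂(n) (1 - a₂^{1 - a₃ⁿ(1-ϑ)ⁿ}) with k₂(n) ≥ 0 summable, a₂ ∈ (0,1), 0 < a₃(1-ϑ) < 1 on the domain. Then f''(ϑ) < 0 on the interior, so f is strictly concave and attains its maximum at a unique ϑ₀ ∈ [0,1] characterized by f'(ϑ₀) = 0 when ϑ₀ is interior. -/

import Mathlib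

/-- Uniform bound on `(n+1)^2 r^n`. -/
lemma scp_bound (r : ℝ) (h0 : 0 < r) (h1 : r < 1) :
    ∃ C : ℝ, 0 < C ∧ ∀ n : ℕ, ((n : ℝ) + 1) ^ 2 * r ^ n ≤ C := by
  have hs : Summable (fun n : ℕ => ((n : ℝ)) ^ 2 * r ^ n) :=
    summable_pow_mul_geometric_of_norm_lt_one 2 (by rwa [Real.norm_of_nonneg h0.le])
  have hs' := (summable_nat_add_iff 1).mpr hs
  obtain ⟨C, hC⟩ := hs'.tendsto_atTop_zero.bddAbove_range
  refine ⟨max 1 (C / r), by positivity, fun n => ?_⟩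
  have h := hC ⟨n, rfl⟩
  simp only at h
  push_cast at h
  refine le_trans ?_ (le_max_right _ _)
  rw [le_div_iff₀ h0]
  calc _ = ((n : ℝ) + 1) ^ 2 * r ^ (n + 1) := by ring
    _ ≤ C := h

/-- The series `∑ k u exp(L (a u)^(n+1))` is twice differentiable on `(0,1)`. -/
lemma scp_series (L a : ℝ) (k : ℕ → ℝ) (hL : 0 < L) (ha0 : 0 < a) (ha1 : a < 1)
    (hk : ∀ n, 0 ≤ k n) (hs : Summable k) :
    ∃ G' G'' : ℝ → ℝ,
      ContinuousOn (fun u => ∑' n : ℕ, k n * (u * Real.exp (L * (a * u) ^ (n + 1)))) (Set.Icc 0 1)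
      ∧ (∀ u ∈ Set.Icc (0 : ℝ) 1, Summable fun n : ℕ => k n * (Real.exp (L * (a * u) ^ (n + 1))))
      ∧ (∀ u ∈ Set.Ioo (0 : ℝ) 1, HasDerivAt
          (fun u => ∑' n : ℕ, k n * (u * Real.exp (L * (a * u) ^ (n + 1)))) (G' u) u)
      ∧ (∀ u ∈ Set.Ioo (0 : ℝ) 1, HasDerivAt G' (G'' u) u)
      ∧ (∀ u ∈ Set.Ioo (0 : ℝ) 1, 0 ≤ G'' u) := by
  obtain ⟨C, hC0, hC⟩ := scp_bound a ha0 ha1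
  have hexp : ∀ u ∈ Set.Icc (0 : ℝ) 1, ∀ n : ℕ,
      Real.exp (L * (a * u) ^ (n + 1)) ≤ Real.exp L := by
    intro u hu n
    apply Real.exp_le_exp.mpr
    have h1 : (a * u) ^ (n + 1) ≤ 1 :=
      pow_le_one₀ (mul_nonneg ha0.le hu.1) (by nlinarith [hu.1, hu.2])
    nlinarith
  have hpow : ∀ u ∈ Set.Icc (0 : ℝ) 1, ∀ n : ℕ, (a * u) ^ n ≤ a ^ n := by
    intro u hu n
    exact pow_le_pow_left₀ (mul_nonneg ha0.le hu.1) (by nlinarith [hu.1, hu.2]) n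
  have hsumE : ∀ u ∈ Set.Icc (0 : ℝ) 1,
      Summable fun n : ℕ => k n * (Real.exp (L * (a * u) ^ (n + 1))) := by
    intro u hu
    refine Summable.of_nonneg_of_le (fun n => mul_nonneg (hk n) (Real.exp_pos _).le)
      (fun n => mul_le_mul_of_nonneg_left (hexp u hu n) (hk n)) (hs.mul_right _)
  have hsumG : ∀ u ∈ Set.Icc (0 : ℝ) 1,
      Summable fun n : ℕ => k n * (u * Real.exp (L * (a * u) ^ (n + 1))) := by
    intro u hu
    refine ((hsumE u hu).mul_left u).congr (fun n => by ring)
  let p1 : ℕ → ℝ → ℝ := fun n u =>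
    k n * (Real.exp (L * (a * u) ^ (n + 1)) * (1 + L * ((n : ℝ) + 1) * (a * u) ^ (n + 1)))
  let p2 : ℕ → ℝ → ℝ := fun n u =>
    k n * (Real.exp (L * (a * u) ^ (n + 1)) * (L * ((n : ℝ) + 1) * (a * u) ^ n * a *
      (1 + ((n : ℝ) + 1) + L * ((n : ℝ) + 1) * (a * u) ^ (n + 1))))
  have hdE : ∀ (n : ℕ) (u : ℝ), HasDerivAt (fun u : ℝ => (a * u) ^ (n + 1))
      (((n : ℝ) + 1) * (a * u) ^ n * a) u := by
    intro n u
    have := ((hasDerivAt_id u).const_mul a).pow (n + 1)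
    refine HasDerivAt.congr_deriv this ?_
    simp
  have hd1 : ∀ (n : ℕ) (u : ℝ), HasDerivAt
      (fun u : ℝ => k n * (u * Real.exp (L * (a * u) ^ (n + 1)))) (p1 n u) u := by
    intro n u
    have := (((hasDerivAt_id u).mul ((hdE n u).const_mul L).exp)).const_mul (k n)
    refine HasDerivAt.congr_deriv this ?_
    simp only [p1, id]
    ring
  have hd2 : ∀ (n : ℕ) (u : ℝ), HasDerivAt (p1 n) (p2 n u) u := by
    intro n u
    have := ((((hdE n u).const_mul L).exp).mul
      (((hdE n u).const_mul (L * ((n : ℝ) + 1))).const_add 1)).const_mul (k n)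
    refine HasDerivAt.congr_deriv this ?_
    simp only [p2]
    ring
  have hau : ∀ u ∈ Set.Icc (0 : ℝ) 1, 0 ≤ a * u := fun u hu => mul_nonneg ha0.le hu.1
  have hau1 : ∀ u ∈ Set.Icc (0 : ℝ) 1, a * u ≤ 1 := fun u hu => by nlinarith [hu.1, hu.2]
  have hb : ∀ u ∈ Set.Icc (0 : ℝ) 1, ∀ n : ℕ, ((n : ℝ) + 1) ^ 2 * (a * u) ^ n ≤ C := by
    intro u hu n
    exact le_trans (mul_le_mul_of_nonneg_left (hpow u hu n) (by positivity)) (hC n)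
  have hb1 : ∀ n : ℕ, ∀ u ∈ Set.Ioo (0 : ℝ) 1, ‖p1 n u‖ ≤ k n * (Real.exp L * (1 + L * C)) := by
    intro n u hu
    have hu' := Set.Ioo_subset_Icc_self hu
    have h0 := hau u hu'
    have hkn := hk n
    rw [Real.norm_of_nonneg (by positivity)]
    have h3 : ((n : ℝ) + 1) * (a * u) ^ (n + 1) ≤ C := by
      refine le_trans ?_ (hb u hu' n)
      apply mul_le_mul _ (pow_le_pow_of_le_one h0 (hau1 u hu') (Nat.le_succ n))
        (by positivity) (by positivity)
      nlinarith [(Nat.cast_nonneg n : (0 : ℝ) ≤ n)]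
    apply mul_le_mul_of_nonneg_left _ hkn
    apply mul_le_mul (hexp u hu' n) _ (by positivity) (by positivity)
    rw [mul_assoc]
    gcongr
  have hp2 : ∀ n : ℕ, ∀ u ∈ Set.Ioo (0 : ℝ) 1, 0 ≤ p2 n u := by
    intro n u hu
    have h0 := hau u (Set.Ioo_subset_Icc_self hu)
    have hkn := hk n
    positivity
  have hb2 : ∀ n : ℕ, ∀ u ∈ Set.Ioo (0 : ℝ) 1,
      ‖p2 n u‖ ≤ k n * (Real.exp L * (L * C * (2 + L))) := by
    intro n u hu
    have hu' := Set.Ioo_subset_Icc_self hu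
    have h0 := hau u hu'
    have hkn := hk n
    rw [Real.norm_of_nonneg (hp2 n u hu)]
    apply mul_le_mul_of_nonneg_left _ hkn
    apply mul_le_mul (hexp u hu' n) _ (by positivity) (by positivity)
    have hn : (0 : ℝ) ≤ n := Nat.cast_nonneg n
    have h4 : (1 + ((n : ℝ) + 1) + L * ((n : ℝ) + 1) * (a * u) ^ (n + 1))
        ≤ ((n : ℝ) + 1) * (2 + L) := by
      have h5 : (a * u) ^ (n + 1) ≤ 1 := pow_le_one₀ h0 (hau1 u hu')
      have h6 : L * ((n : ℝ) + 1) * (a * u) ^ (n + 1) ≤ L * ((n : ℝ) + 1) * 1 := by gcongr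
      nlinarith
    calc L * ((n : ℝ) + 1) * (a * u) ^ n * a *
          (1 + ((n : ℝ) + 1) + L * ((n : ℝ) + 1) * (a * u) ^ (n + 1))
        ≤ L * ((n : ℝ) + 1) * (a * u) ^ n * 1 * (((n : ℝ) + 1) * (2 + L)) := by gcongr
      _ = L * (((n : ℝ) + 1) ^ 2 * (a * u) ^ n) * (2 + L) := by ring
      _ ≤ L * C * (2 + L) := by
        have := hb u hu' n
        gcongr
  have hhalf : (1 / 2 : ℝ) ∈ Set.Ioo (0 : ℝ) 1 := by constructor <;> norm_num
  have hsum1 : Summable fun n => p1 n (1 / 2) :=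
    Summable.of_norm_bounded (hs.mul_right _) (fun n => hb1 n _ hhalf)
  refine ⟨fun u => ∑' n, p1 n u, fun u => ∑' n, p2 n u, ?_, hsumE, ?_, ?_, ?_⟩
  · refine continuousOn_tsum (u := fun n => k n * Real.exp L)
      (fun n => by fun_prop) (hs.mul_right _) ?_
    intro n u hu
    have hkn := hk n
    have hu0 := hu.1
    rw [Real.norm_of_nonneg (by positivity)]
    apply mul_le_mul_of_nonneg_left _ hkn
    calc _ ≤ 1 * Real.exp L := mul_le_mul hu.2 (hexp u hu n) (by positivity) (by norm_num)
      _ = _ := one_mul _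
  · intro u hu
    exact hasDerivAt_tsum_of_isPreconnected (hs.mul_right _) isOpen_Ioo isPreconnected_Ioo
      (fun n y _ => hd1 n y) hb1 hhalf (hsumG _ (Set.Ioo_subset_Icc_self hhalf)) hu
  · intro u hu
    exact hasDerivAt_tsum_of_isPreconnected (hs.mul_right _) isOpen_Ioo isPreconnected_Ioo
      (fun n y _ => hd2 n y) hb2 hhalf hsum1 hu
  · intro u hu
    exact tsum_nonneg (fun n => hp2 n u hu)

/-- Strict concavity of the successful computation probability in the offloading
probability `ϑ`: `f''(ϑ) < 0` on the interior, `f` is strictly concave on `[0,1]`,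
it attains its maximum at a unique `ϑ₀ ∈ [0,1]`, and any interior maximizer
satisfies `f'(ϑ₀) = 0`. -/
theorem scp_strictly_concave_in_offloading (a1 a2 a3 k1 t : ℝ) (k2 : ℕ → ℝ)
    (ha1 : a1 ∈ Set.Ioo (0 : ℝ) 1) (ha2 : a2 ∈ Set.Ioo (0 : ℝ) 1)
    (ha3 : a3 ∈ Set.Ioo (0 : ℝ) 1)
    (hk1 : 0 < k1) (ht : 0 < t) (hk2 : ∀ n, 0 ≤ k2 n) (hsum : Summable k2)
    (f A B : ℝ → ℝ)
    (hA : A = fun th => 1 - a1 * Real.exp (k1 * th * t))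
    (hB : B = fun th => ∑' n : ℕ, k2 (n + 1) * (1 - a2 ^ (1 - (a3 * (1 - th)) ^ (n + 1))))
    (hf : f = fun th => th * A th + (1 - th) * B th) :
    (∀ th ∈ Set.Ioo (0 : ℝ) 1, deriv (deriv f) th < 0)
      ∧ StrictConcaveOn ℝ (Set.Icc 0 1) f
      ∧ (∃! th0, th0 ∈ Set.Icc (0 : ℝ) 1 ∧ IsMaxOn f (Set.Icc 0 1) th0)
      ∧ (∀ th0 ∈ Set.Ioo (0 : ℝ) 1, IsMaxOn f (Set.Icc 0 1) th0 → deriv f th0 = 0) := by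
  obtain ⟨ha2p, ha21⟩ := ha2
  have hL : 0 < -Real.log a2 := neg_pos.mpr (Real.log_neg ha2p ha21)
  have hsk : Summable (fun n => k2 (n + 1)) := (summable_nat_add_iff 1).mpr hsum
  obtain ⟨G', G'', hGc, hGs, hG1, hG2, hGn⟩ := scp_series (-Real.log a2) a3
    (fun n => k2 (n + 1)) hL ha3.1 ha3.2 (fun n => hk2 _) hsk
  set G : ℝ → ℝ := fun u =>
    ∑' n : ℕ, k2 (n + 1) * (u * Real.exp (-Real.log a2 * (a3 * u) ^ (n + 1))) with hG
  set S : ℝ := ∑' n : ℕ, k2 (n + 1) with hS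
  let F : ℝ → ℝ := fun th =>
    th * (1 - a1 * Real.exp (k1 * th * t)) + ((1 - th) * S - a2 * G (1 - th))
  have hfF : Set.EqOn f F (Set.Icc 0 1) := by
    intro th hth
    have hu : 1 - th ∈ Set.Icc (0 : ℝ) 1 := ⟨by linarith [hth.2], by linarith [hth.1]⟩
    have hs1 := hGs _ hu
    have hB' : B th = S - a2 * ∑' n : ℕ, k2 (n + 1) *
        Real.exp (-Real.log a2 * (a3 * (1 - th)) ^ (n + 1)) := by
      rw [hB, hS, ← tsum_mul_left, ← hsk.tsum_sub (hs1.mul_left a2)]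
      refine tsum_congr (fun n => ?_)
      rw [Real.rpow_def_of_pos ha2p, mul_sub (Real.log a2), mul_one, sub_eq_add_neg (Real.log a2),
        Real.exp_add, Real.exp_log ha2p, neg_mul]
      ring
    have hG' : G (1 - th) = (1 - th) * ∑' n : ℕ, k2 (n + 1) *
        Real.exp (-Real.log a2 * (a3 * (1 - th)) ^ (n + 1)) := by
      rw [hG, ← tsum_mul_left]
      exact tsum_congr (fun n => by ring)
    rw [hf]
    simp only [F]
    rw [hB', hG', hA]
    ring
  have hmem : ∀ th ∈ Set.Ioo (0 : ℝ) 1, 1 - th ∈ Set.Ioo (0 : ℝ) 1 :=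
    fun th h => ⟨by linarith [h.2], by linarith [h.1]⟩
  have hcont : ContinuousOn f (Set.Icc 0 1) := by
    refine ContinuousOn.congr ?_ hfF
    have hc : ContinuousOn (fun th : ℝ => G (1 - th)) (Set.Icc 0 1) :=
      hGc.comp (by fun_prop) (fun th h => ⟨by linarith [h.2], by linarith [h.1]⟩)
    have hc2 : Continuous (fun th : ℝ => th * (1 - a1 * Real.exp (k1 * th * t))) := by fun_prop
    have hc3 : Continuous (fun th : ℝ => (1 - th) * S) := by fun_prop
    exact hc2.continuousOn.add (hc3.continuousOn.sub (hc.const_smul a2))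
  let F' : ℝ → ℝ := fun th =>
    (1 - a1 * Real.exp (k1 * th * t)) - th * (a1 * (Real.exp (k1 * th * t) * (k1 * t)))
      + (-S + a2 * G' (1 - th))
  have hdexp : ∀ th : ℝ, HasDerivAt (fun th => Real.exp (k1 * th * t))
      (Real.exp (k1 * th * t) * (k1 * t)) th := by
    intro th
    have := (((hasDerivAt_id th).const_mul k1).mul_const t).exp
    simpa using this
  have hsub : ∀ th : ℝ, HasDerivAt (fun th : ℝ => 1 - th) (-1) th := fun th => by
    simpa using (hasDerivAt_id th).const_sub 1
  have hF1 : ∀ th ∈ Set.Ioo (0 : ℝ) 1, HasDerivAt f (F' th) th := by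
    intro th hth
    have hg : HasDerivAt (fun th : ℝ => G (1 - th)) (G' (1 - th) * -1) th :=
      HasDerivAt.comp th (hG1 _ (hmem th hth)) (hsub th)
    have h1 := ((hasDerivAt_id th).mul (((hdexp th).const_mul a1).const_sub 1)).add
      (((hsub th).mul_const S).sub (hg.const_mul a2))
    have h2 : HasDerivAt F (F' th) th := by
      refine HasDerivAt.congr_deriv h1 ?_
      simp only [F', id]
      ring
    refine h2.congr_of_eventuallyEq ?_
    filter_upwards [Ioo_mem_nhds hth.1 hth.2] with y hy
    exact hfF (Set.Ioo_subset_Icc_self hy)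
  have hF2 : ∀ th ∈ Set.Ioo (0 : ℝ) 1, deriv (deriv f) th < 0 := by
    intro th hth
    have hg : HasDerivAt (fun th : ℝ => G' (1 - th)) (G'' (1 - th) * -1) th :=
      HasDerivAt.comp th (hG2 _ (hmem th hth)) (hsub th)
    have h1 := ((((hdexp th).const_mul a1).const_sub 1).sub ((hasDerivAt_id th).mul
      (((hdexp th).mul_const (k1 * t)).const_mul a1))).add
      ((hg.const_mul a2).const_add (-S))
    have h2 : HasDerivAt F' (-(a1 * Real.exp (k1 * th * t) * (k1 * t) * (2 + th * (k1 * t)))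
        - a2 * G'' (1 - th)) th := by
      refine HasDerivAt.congr_deriv h1 ?_
      simp only [id]
      ring
    have h3 : deriv f =ᶠ[nhds th] F' := by
      filter_upwards [Ioo_mem_nhds hth.1 hth.2] with y hy
      exact (hF1 y hy).deriv
    rw [h3.deriv_eq, h2.deriv]
    have h4 := mul_nonneg ha2p.le (hGn _ (hmem th hth))
    have h5 : 0 < a1 * Real.exp (k1 * th * t) * (k1 * t) * (2 + th * (k1 * t)) := by
      have := ha1.1
      have := hth.1
      positivity
    linarith
  have hconc : StrictConcaveOn ℝ (Set.Icc 0 1) f := by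
    refine strictConcaveOn_of_deriv2_neg (convex_Icc 0 1) hcont (fun x hx => ?_)
    rw [interior_Icc] at hx
    exact hF2 x hx
  refine ⟨hF2, hconc, ?_, ?_⟩
  · obtain ⟨x, hx, hmax⟩ := isCompact_Icc.exists_isMaxOn
      (Set.nonempty_Icc.mpr (zero_le_one (α := ℝ))) hcont
    exact ⟨x, ⟨hx, hmax⟩, fun y hy => hconc.eq_of_isMaxOn hy.2 hmax hy.1 hx⟩
  · intro th hth hmax
    exact (hmax.isLocalMax (Icc_mem_nhds hth.1 hth.2)).deriv_eq_zero
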